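/- Let V be a module over k[x_1,…,x_d] with a proper filtration M_1 ⊆ M_2 ⊆ ··· of finite-dimensional subspaces (meaning V = ∪M_n, x_iM_n ⊆ M_{n+1}, and M_{n+1} = M_n + x_1M_n + ··· + x_dM_n for all large n). Then the limit c = d!·lim_{n→∞} dim M_n / n^d exists, is a nonnegative integer, and is independent of the choice of proper filtration. -/

import Mathlib

open Filter

/-- A proper filtration of a module `V` over `k[x_1,…,x_d]`: an increasing sequence of
finite-dimensional `k`-subspaces covering `V`, with `x_i M_n ⊆ M_{n+1}`, and
`M_{n+1} = M_n + x_1 M_n + ⋯ + x_d M_n` for all sufficiently large `n`. -/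
def IsProperFiltration (K : Type*) [Field K] (d : ℕ) (V : Type*) [AddCommGroup V]
    [Module (MvPolynomial (Fin d) K) V] [Module K V]
    [IsScalarTower K (MvPolynomial (Fin d) K) V] (M : ℕ → Submodule K V) : Prop :=
  Monotone M ∧ (∀ n, FiniteDimensional K (M n)) ∧ (∀ v : V, ∃ n, v ∈ M n) ∧
  (∀ (i : Fin d) (n : ℕ), ∀ v ∈ M n,
    (MvPolynomial.X i : MvPolynomial (Fin d) K) • v ∈ M (n + 1)) ∧
  (∃ n₀ : ℕ, ∀ n ≥ n₀, ∀ v ∈ M (n + 1), ∃ w ∈ M n, ∃ u : Fin d → V,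
    (∀ i, u i ∈ M n) ∧
    v = w + ∑ i, (MvPolynomial.X i : MvPolynomial (Fin d) K) • u i)


lemma sh_add (f : ℕ → ℝ) (d : ℕ) (l : ℝ) (a : ℕ)
    (h : Tendsto (fun n : ℕ => f n / (n:ℝ)^d) atTop (nhds l)) :
    Tendsto (fun n : ℕ => f (n+a) / (n:ℝ)^d) atTop (nhds l) := by
  have h1 := h.comp (tendsto_add_atTop_nat a)
  have h2 : Tendsto (fun n : ℕ => (1 + (a:ℝ) / (n:ℝ))^d) atTop (nhds ((1+0)^d)) :=
    (tendsto_const_nhds.add (tendsto_const_div_atTop_nhds_zero_nat (a:ℝ))).pow d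
  have h3 := h1.mul h2
  simp only [add_zero, one_pow, mul_one] at h3
  refine h3.congr' ?_
  filter_upwards [eventually_gt_atTop 0] with n hn
  have : (n:ℝ) ≠ 0 := by positivity
  have h5 : ((n:ℝ) + a) ≠ 0 := by positivity
  have : 1 + (a:ℝ)/n = (n + a) / n := by field_simp
  rw [this, div_pow]
  simp only [Function.comp, Nat.cast_add]
  field_simp

lemma sh_sub (f : ℕ → ℝ) (d : ℕ) (l : ℝ) (a : ℕ)
    (h : Tendsto (fun n : ℕ => f n / (n:ℝ)^d) atTop (nhds l)) :
    Tendsto (fun n : ℕ => f (n-a) / (n:ℝ)^d) atTop (nhds l) := by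
  have h1 := h.comp (tendsto_sub_atTop_nat a)
  have h2 : Tendsto (fun n : ℕ => (1 - (a:ℝ) / (n:ℝ))^d) atTop (nhds ((1-0)^d)) :=
    (tendsto_const_nhds.sub (tendsto_const_div_atTop_nhds_zero_nat (a:ℝ))).pow d
  have h3 := h1.mul h2
  simp only [sub_zero, one_pow, mul_one] at h3
  refine h3.congr' ?_
  filter_upwards [eventually_gt_atTop a] with n hn
  have h0 : 0 < n := by omega
  have : (n:ℝ) ≠ 0 := by positivity
  have h5 : ((n:ℝ) - a) ≠ 0 := by
    have : (a:ℝ) < n := by exact_mod_cast hn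
    linarith
  have : 1 - (a:ℝ)/n = (n - a) / n := by field_simp
  rw [this, div_pow]
  simp only [Function.comp, Nat.cast_sub hn.le]
  field_simp

lemma choose_lim (d : ℕ) :
    Tendsto (fun n : ℕ => ((d.factorial : ℝ) * ((n+d).choose d : ℝ)) / (n:ℝ)^d) atTop (nhds 1) := by
  apply sh_add (fun n => (d.factorial : ℝ) * ((n).choose d : ℝ)) d 1 d
  have h := ProbabilityTheory.tendsto_choose_mul_pow_atTop (p := fun n => 1 / (n:ℝ)) (r := 1) d ?_
  · have h2 := h.const_mul (d.factorial : ℝ)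
    have : (d.factorial : ℝ) ≠ 0 := by positivity
    rw [one_pow, mul_one_div_cancel this] at h2
    refine h2.congr fun n => ?_
    simp
    ring
  · refine tendsto_const_nhds.congr' ?_
    filter_upwards [eventually_gt_atTop 0] with n hn
    have : (n:ℝ) ≠ 0 := by positivity
    field_simp

noncomputable def cntEquiv (d n : ℕ) : {s : Fin d →₀ ℕ | (s.sum fun _ e => e) ≤ n} ≃
    {P : Fin (d+1) → ℕ // ∑ i, P i = n} where
  toFun s := ⟨Fin.cons (n - ∑ i, s.1 i) s.1, by
    have := s.2
    rw [Set.mem_ofPred_eq, Finsupp.sum_fintype _ _ (by simp)] at this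
    simp [Fin.sum_univ_succ]; omega⟩
  invFun P := ⟨Finsupp.equivFunOnFinite.symm (Fin.tail P.1), by
    have := P.2
    rw [Fin.sum_univ_succ] at this
    simp [Finsupp.sum_fintype]; simp only [Fin.tail]; omega⟩
  left_inv s := by
    ext; simp
  right_inv P := by
    ext i
    have := P.2
    rw [Fin.sum_univ_succ] at this
    refine Fin.cases ?_ (fun i => ?_) i <;> simp [Fin.tail]
    omega

lemma P_dim (K : Type*) [Field K] (d n : ℕ) :
    Module.finrank K (MvPolynomial.restrictTotalDegree (Fin d) K n) = (n+d).choose d := by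
  rw [MvPolynomial.restrictTotalDegree, Module.finrank_eq_nat_card_basis (MvPolynomial.basisRestrictSupport K _)]
  rw [Nat.card_congr ((cntEquiv d n).trans (Sym.equivNatSumOfFintype _ _).symm)]
  rw [Nat.card_eq_fintype_card, Sym.card_sym_eq_choose, Fintype.card_fin]
  rw [show d + 1 + n - 1 = n + d by omega, Nat.choose_symm_add]

lemma sup_dim {K E V : Type*} [Field K] [AddCommGroup E] [Module K E] [AddCommGroup V] [Module K V]
    (φ : E →ₗ[K] V) (W : Submodule K V) (A U : Submodule K E) [FiniteDimensional K W]
    [FiniteDimensional K A] (hU : U ≤ A) (hW : U.map φ ≤ W) :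
    Module.finrank K ↥(W ⊔ A.map φ) + Module.finrank K U ≤ Module.finrank K W + Module.finrank K A := by
  obtain ⟨C, hC⟩ := U.exists_isCompl
  have e1 : U ⊔ (C ⊓ A) = A := by
    rw [← sup_inf_assoc_of_le C hU, hC.sup_eq_top, top_inf_eq]
  have e2 : U ⊓ (C ⊓ A) = ⊥ := by
    rw [← inf_assoc, hC.inf_eq_bot, bot_inf_eq]
  have : FiniteDimensional K U := Submodule.finiteDimensional_of_le hU
  have : FiniteDimensional K ↥(C ⊓ A) := Submodule.finiteDimensional_of_le inf_le_right
  have h1 := Submodule.finrank_sup_add_finrank_inf_eq U (C ⊓ A)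
  rw [e1, e2, finrank_bot] at h1
  have e3 : W ⊔ A.map φ = W ⊔ (C ⊓ A).map φ := by
    rw [← e1, Submodule.map_sup, ← sup_assoc, sup_eq_left.2 hW, e1]
  rw [e3]
  have h2 := Submodule.finrank_add_le_finrank_add_finrank W ((C ⊓ A).map φ)
  have h3 := Submodule.finrank_map_le φ (C ⊓ A)
  omega

section Aux
open MvPolynomial
variable {K : Type*} [Field K] {d : ℕ} {V : Type*} [AddCommGroup V]
  [Module (MvPolynomial (Fin d) K) V] [Module K V]
  [IsScalarTower K (MvPolynomial (Fin d) K) V] {ι : Type*}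

noncomputable def phi (K : Type*) [Field K] (d : ℕ) {V : Type*} [AddCommGroup V]
    [Module (MvPolynomial (Fin d) K) V] [Module K V]
    [IsScalarTower K (MvPolynomial (Fin d) K) V] (x : V) : MvPolynomial (Fin d) K →ₗ[K] V :=
  (LinearMap.toSpanSingleton (MvPolynomial (Fin d) K) V x).restrictScalars K

lemma phi_apply (x : V) (a : MvPolynomial (Fin d) K) : phi K d x a = a • x := rfl

noncomputable def GS (K : Type*) [Field K] (d : ℕ) {V : Type*} [AddCommGroup V]
    [Module (MvPolynomial (Fin d) K) V] [Module K V]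
    [IsScalarTower K (MvPolynomial (Fin d) K) V] (v : ι → V) (S : Finset ι) (n : ℕ) :
    Submodule K V :=
  S.sup fun i => (restrictTotalDegree (Fin d) K n).map (phi K d (v i))

lemma R_mono {n m : ℕ} (h : n ≤ m) :
    restrictTotalDegree (Fin d) K n ≤ restrictTotalDegree (Fin d) K m := by
  intro p hp
  rw [mem_restrictTotalDegree] at *
  omega

lemma RTD_mul {n m : ℕ} {p q : MvPolynomial (Fin d) K} (hp : p ∈ restrictTotalDegree (Fin d) K n)
    (hq : q ∈ restrictTotalDegree (Fin d) K m) : p * q ∈ restrictTotalDegree (Fin d) K (n+m) := by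
  rw [mem_restrictTotalDegree] at *
  have := totalDegree_mul p q
  omega

lemma GS_mono (v : ι → V) (S : Finset ι) : Monotone (GS K d v S) := by
  intro n m h
  exact Finset.sup_mono_fun fun i _ => Submodule.map_mono (R_mono h)

lemma GS_gen (v : ι → V) (S : Finset ι) {n : ℕ} {a : MvPolynomial (Fin d) K}
    (ha : a ∈ restrictTotalDegree (Fin d) K n) {i : ι} (hi : i ∈ S) : a • v i ∈ GS K d v S n :=
  (Finset.le_sup (f := fun i => (restrictTotalDegree (Fin d) K n).map (phi K d (v i))) hi)
    ⟨a, ha, rfl⟩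

lemma GS_empty (v : ι → V) (n : ℕ) : GS K d v ∅ n = ⊥ := Finset.sup_empty

lemma GS_smul (v : ι → V) (S : Finset ι) {n m : ℕ} {a : MvPolynomial (Fin d) K}
    (ha : a ∈ restrictTotalDegree (Fin d) K n) {x : V} (hx : x ∈ GS K d v S m) :
    a • x ∈ GS K d v S (n + m) := by
  have : GS K d v S m ≤ (GS K d v S (n+m)).comap (DistribSMul.toLinearMap K V a) := by
    refine Finset.sup_le fun i hi => ?_
    rintro _ ⟨b, hb, rfl⟩
    simp only [Submodule.mem_comap, DistribSMul.toLinearMap_apply, phi_apply, ← mul_smul]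
    exact GS_gen v S (RTD_mul ha hb) hi
  exact this hx

lemma GS_span (v : ι → V) (S : Finset ι) (x : V)
    (hx : x ∈ Submodule.span (MvPolynomial (Fin d) K) (v '' S)) : ∃ n, x ∈ GS K d v S n := by
  induction hx using Submodule.span_induction with
  | mem x h =>
    obtain ⟨i, hi, rfl⟩ := h
    refine ⟨0, ?_⟩
    rw [← one_smul (MvPolynomial (Fin d) K) (v i)]
    exact GS_gen v S (by rw [mem_restrictTotalDegree]; simp) hi
  | zero => exact ⟨0, zero_mem _⟩
  | add x y _ _ hx hy =>
    obtain ⟨n, hn⟩ := hx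
    obtain ⟨m, hm⟩ := hy
    exact ⟨max n m, add_mem (GS_mono v S (le_max_left _ _) hn) (GS_mono v S (le_max_right _ _) hm)⟩
  | smul a x _ hx =>
    obtain ⟨n, hn⟩ := hx
    exact ⟨_, GS_smul v S ((mem_restrictTotalDegree _ _ _).2 le_rfl) hn⟩

instance GS_fin (v : ι → V) (S : Finset ι) (n : ℕ) : FiniteDimensional K (GS K d v S n) :=
  Submodule.finiteDimensional_finset_sup _ _

lemma fin_le (G : ℕ → Submodule K V) (hG : Monotone G) (h : ∀ x, ∃ n, x ∈ G n)
    (W : Submodule K V) [FiniteDimensional K W] : ∃ t, W ≤ G t := by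
  obtain ⟨s, hs⟩ := (Submodule.fg_iff_finiteDimensional W).2 ‹_›
  choose f hf using h
  refine ⟨s.sup f, ?_⟩
  rw [← hs, Submodule.span_le]
  intro x hx
  exact hG (Finset.le_sup (f := f) hx) (hf x)

lemma M_smul (M : ℕ → Submodule K V) (hM : IsProperFiltration K d V M) {n m : ℕ}
    {a : MvPolynomial (Fin d) K} (ha : a ∈ restrictTotalDegree (Fin d) K n) {x : V}
    (hx : x ∈ M m) : a • x ∈ M (n + m) := by
  obtain ⟨h1, h2, h3, h4, h5⟩ := hM
  have key : ∀ s : Fin d →₀ ℕ, ∀ m, ∀ x ∈ M m,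
      (monomial s (1:K)) • x ∈ M (s.degree + m) := by
    intro s
    induction s using Finsupp.induction_linear with
    | zero => intro m x hx; simpa using hx
    | add f g hf hg =>
      intro m x hx
      have := hf _ _ (hg _ _ hx)
      rw [← mul_smul, monomial_mul, one_mul] at this
      rw [map_add, add_assoc]; exact this
    | single i k =>
      induction k with
      | zero => intro m x hx; simpa using hx
      | succ k ih =>
        intro m x hx
        have := h4 i _ _ (ih m x hx)
        rw [X, ← mul_smul, monomial_mul, one_mul, ← Finsupp.single_add] at this
        rw [Finsupp.degree_single] at *
        rw [show k + 1 + m = k + m + 1 by omega, add_comm k 1]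
        exact this
  have : restrictTotalDegree (Fin d) K n ≤ (M (n+m)).comap (phi K d x) := by
    rw [restrictTotalDegree, restrictSupport_eq_span, Submodule.span_le]
    rintro _ ⟨s, hs, rfl⟩
    have hs' : s.degree ≤ n := hs
    exact h1 (by omega) (key s m x hx)
  exact this ha

lemma G_le_M (v : ι → V) (S : Finset ι) (M : ℕ → Submodule K V)
    (hM : IsProperFiltration K d V M) : ∃ s, ∀ n, GS K d v S n ≤ M (n + s) := by
  choose f hf using hM.2.2.1
  refine ⟨S.sup (f ∘ v), fun n => Finset.sup_le fun i hi => ?_⟩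
  rintro _ ⟨b, hb, rfl⟩
  exact M_smul M hM hb (hM.1 (Finset.le_sup (f := f ∘ v) hi) (hf (v i)))

lemma M_le_G (v : ι → V) (S : Finset ι)
    (hv : Submodule.span (MvPolynomial (Fin d) K) (v '' S) = ⊤) (M : ℕ → Submodule K V)
    (hM : IsProperFiltration K d V M) : ∃ t, ∀ n, M n ≤ GS K d v S (n + t) := by
  obtain ⟨h1, h2, h3, h4, n₀, h5⟩ := hM
  have := h2 n₀
  obtain ⟨t, ht⟩ := fin_le (GS K d v S) (GS_mono v S)
    (fun x => GS_span v S x (by rw [hv]; trivial)) (M n₀)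
  have key : ∀ n, M (n + n₀) ≤ GS K d v S (n + t) := by
    intro n
    induction n with
    | zero => simpa using ht
    | succ n ih =>
      intro x hx
      rw [show n + 1 + n₀ = n + n₀ + 1 by omega] at hx
      obtain ⟨w, hw, u, hu, rfl⟩ := h5 (n + n₀) (by omega) x hx
      refine add_mem (GS_mono v S (by omega) (ih hw)) (sum_mem fun i _ => ?_)
      have := GS_smul v S (n := 1) (a := X i) (by rw [mem_restrictTotalDegree]; simp) (ih (hu i))
      rwa [show n + 1 + t = 1 + (n + t) by omega]
  exact ⟨t, fun n => (h1 (by omega)).trans (key n)⟩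

lemma exists_gen (M : ℕ → Submodule K V) (hM : IsProperFiltration K d V M) :
    ∃ S : Finset V, Submodule.span (MvPolynomial (Fin d) K) (S : Set V) = ⊤ := by
  obtain ⟨h1, h2, h3, h4, n₀, h5⟩ := hM
  obtain ⟨s, hs⟩ := (Submodule.fg_iff_finiteDimensional (M n₀)).2 (h2 _)
  refine ⟨s, eq_top_iff.2 fun x _ => ?_⟩
  have key : ∀ n, ∀ x ∈ M (n + n₀), x ∈ Submodule.span (MvPolynomial (Fin d) K) (s : Set V) := by
    intro n
    induction n with
    | zero =>
      intro x hx
      rw [zero_add, ← hs] at hx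
      exact Submodule.span_le_restrictScalars K (MvPolynomial (Fin d) K) _ hx
    | succ n ih =>
      intro x hx
      rw [show n + 1 + n₀ = n + n₀ + 1 by omega] at hx
      obtain ⟨w, hw, u, hu, rfl⟩ := h5 (n + n₀) (by omega) x hx
      exact add_mem (ih _ hw) (sum_mem fun i _ => Submodule.smul_mem _ _ (ih _ (hu i)))
  obtain ⟨n, hn⟩ := h3 x
  exact key n x (h1 (by omega) hn)

lemma sup_bound (v : ι → V) (T : Finset ι) (n e : ℕ) (he : e ≤ n) (W : Submodule K V)
    [FiniteDimensional K W]
    (h : ∀ i ∈ T, ∃ f : MvPolynomial (Fin d) K, f ≠ 0 ∧ f.totalDegree ≤ e ∧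
      ∀ a ∈ restrictTotalDegree (Fin d) K (n - e), (a * f) • v i ∈ W) :
    Module.finrank K ↥(W ⊔ GS K d v T n) + T.card * (n - e + d).choose d ≤
      Module.finrank K W + T.card * (n + d).choose d := by
  classical
  induction T using Finset.induction_on with
  | empty => rw [GS_empty, sup_bot_eq]; simp
  | insert i T hi ih =>
    have ih := ih fun j hj => h j (Finset.mem_insert_of_mem hj)
    obtain ⟨f, hf, hfe, hW⟩ := h i (Finset.mem_insert_self _ _)
    have hinj : Function.Injective (LinearMap.mulRight K f) := fun a b hab =>
      mul_right_cancel₀ hf hab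
    have := sup_dim (phi K d (v i)) (W ⊔ GS K d v T n) (restrictTotalDegree (Fin d) K n)
      ((restrictTotalDegree (Fin d) K (n - e)).map (LinearMap.mulRight K f)) ?_ ?_
    · rw [← (Submodule.equivMapOfInjective _ hinj _).finrank_eq, P_dim, P_dim] at this
      have e1 : W ⊔ GS K d v (insert i T) n =
        W ⊔ GS K d v T n ⊔ (restrictTotalDegree (Fin d) K n).map (phi K d (v i)) := by
        simp only [GS, Finset.sup_insert]
        rw [sup_assoc]; congr 1; rw [sup_comm]
      rw [e1, Finset.card_insert_of_notMem hi]
      linarith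
    · rintro _ ⟨a, ha, rfl⟩
      have : f ∈ restrictTotalDegree (Fin d) K e := (mem_restrictTotalDegree _ _ _).2 hfe
      have := RTD_mul ha this
      rwa [Nat.sub_add_cancel he] at this
    · rintro _ ⟨_, ⟨a, ha, rfl⟩, rfl⟩
      exact le_sup_left (a := W) (hW a ha)

lemma GS_upper (v : ι → V) (S : Finset ι) (n : ℕ) :
    Module.finrank K (GS K d v S n) ≤ S.card * (n + d).choose d := by
  classical
  induction S using Finset.induction_on with
  | empty => simp [GS_empty]
  | insert i T hi ih =>
    have := Submodule.finrank_add_le_finrank_add_finrank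
      ((restrictTotalDegree (Fin d) K n).map (phi K d (v i))) (GS K d v T n)
    have h2 := Submodule.finrank_map_le (phi K d (v i)) (restrictTotalDegree (Fin d) K n)
    rw [P_dim] at h2
    rw [Finset.card_insert_of_notMem hi, GS, Finset.sup_insert]
    change Module.finrank K ↥(_ ⊔ GS K d v T n) ≤ _
    linarith

lemma GS_lower (v : ι → V) (S : Finset ι)
    (hS : LinearIndepOn (MvPolynomial (Fin d) K) v (S : Set ι)) (n : ℕ) :
    S.card * (n + d).choose d ≤ Module.finrank K (GS K d v S n) := by
  let L : (S → MvPolynomial (Fin d) K) →ₗ[K] V :=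
    (Fintype.linearCombination (MvPolynomial (Fin d) K) (fun i : S => v i)).restrictScalars K
  let J : (S → restrictTotalDegree (Fin d) K n) →ₗ[K] (S → MvPolynomial (Fin d) K) :=
    LinearMap.pi fun i => (Submodule.subtype _).comp (LinearMap.proj i)
  have hL : Function.Injective L := by
    have := (linearIndependent_iff_injective_fintypeLinearCombination
      (R := MvPolynomial (Fin d) K) (v := fun i : S => v i)).1 hS
    exact this
  have hJ : Function.Injective J := by
    intro a b hab
    ext1 i
    exact Subtype.ext (congrFun hab i)
  have hmem : ∀ c, (L.comp J) c ∈ GS K d v S n := by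
    intro c
    change Fintype.linearCombination (MvPolynomial (Fin d) K) (fun i : S => v i) (J c) ∈ _
    rw [Fintype.linearCombination_apply]
    exact sum_mem fun i _ => GS_gen v S (c i).2 i.2
  have := LinearMap.finrank_le_finrank_of_injective
    (f := (L.comp J).codRestrict (GS K d v S n) hmem)
    (fun a b hab => hJ (hL (congrArg Subtype.val hab)))
  rw [Module.finrank_pi_fintype] at this
  simpa [P_dim] using this

lemma GS_lim [Fintype ι] (v : ι → V) : ∃ c : ℕ,
    Tendsto (fun n : ℕ => ((d.factorial : ℝ) *
      (Module.finrank K (GS K d v Finset.univ n) : ℝ)) / (n : ℝ) ^ d) atTop (nhds (c : ℝ)) := by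
  classical
  obtain ⟨s, hs, hs2⟩ := exists_maximal_linearIndepOn (MvPolynomial (Fin d) K) v
  obtain ⟨S, rfl⟩ : ∃ S : Finset ι, (S : Set ι) = s := ⟨s.toFinset, by simp⟩
  have hs3 : ∀ i, ∃ (f : MvPolynomial (Fin d) K) (m : ℕ), i ∉ S → f ≠ 0 ∧
      f • v i ∈ GS K d v S m := by
    intro i
    by_cases hi : i ∈ S
    · exact ⟨0, 0, fun h => absurd hi h⟩
    · obtain ⟨f, hf, hf2⟩ := hs2 i (by simpa using hi)
      obtain ⟨m, hm⟩ := GS_span v S _ hf2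
      exact ⟨f, m, fun _ => ⟨hf, hm⟩⟩
  choose f m hfm using hs3
  set e := Finset.univ.sup fun i => (f i).totalDegree with he
  set t := Finset.univ.sup m with ht
  have up : ∀ n ≥ e, Module.finrank K (GS K d v Finset.univ n) + Sᶜ.card * (n - e + d).choose d ≤
      S.card * (n + t + d).choose d + Sᶜ.card * (n + d).choose d := by
    intro n hn
    have h1 := sup_bound v Sᶜ n e hn (GS K d v S (n + t)) (fun i hi => by
      obtain ⟨h1, h2⟩ := hfm i (by simpa using hi)
      refine ⟨f i, h1, Finset.le_sup (f := fun i => (f i).totalDegree) (Finset.mem_univ i), ?_⟩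
      intro a ha
      rw [mul_smul]
      have h3 : m i ≤ t := Finset.le_sup (Finset.mem_univ i)
      exact GS_mono v S (by omega) (GS_smul v S ha h2))
    have h2 := GS_upper (K := K) (d := d) v S (n + t)
    have h3 : GS K d v Finset.univ n ≤ GS K d v S (n + t) ⊔ GS K d v Sᶜ n := by
      refine Finset.sup_le fun i _ => ?_
      rintro _ ⟨a, ha, rfl⟩
      by_cases hi : i ∈ S
      · exact le_sup_left (a := GS K d v S (n + t))
          (GS_mono v S (Nat.le_add_right _ _) (GS_gen v S ha hi))
      · exact le_sup_right (a := GS K d v S (n + t)) (GS_gen v Sᶜ ha (by simpa using hi))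
    have h4 := Submodule.finrank_mono h3
    omega
  have low : ∀ n, S.card * (n + d).choose d ≤ Module.finrank K (GS K d v Finset.univ n) := by
    intro n
    refine (GS_lower v S hs n).trans (Submodule.finrank_mono ?_)
    exact Finset.sup_mono (Finset.subset_univ S)
  have c0 := choose_lim d
  have ct := sh_add (fun n => (d.factorial : ℝ) * ((n + d).choose d : ℝ)) d 1 t c0
  have ce := sh_sub (fun n => (d.factorial : ℝ) * ((n + d).choose d : ℝ)) d 1 e c0
  have l1 := c0.const_mul (S.card : ℝ)
  have l2 := ((ct.const_mul (S.card : ℝ)).add (c0.const_mul (Sᶜ.card : ℝ))).sub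
    (ce.const_mul (Sᶜ.card : ℝ))
  rw [mul_one] at l1
  rw [mul_one, mul_one, add_sub_cancel_right] at l2
  refine ⟨S.card, tendsto_of_tendsto_of_tendsto_of_le_of_le' l1 l2 ?_ ?_⟩
  · refine Eventually.of_forall fun n => ?_
    have h : (S.card : ℝ) * ((n + d).choose d : ℝ) ≤
        (Module.finrank K (GS K d v Finset.univ n) : ℝ) := by exact_mod_cast low n
    rw [← mul_div_assoc]
    refine div_le_div_of_nonneg_right ?_ (by positivity)
    calc _ = (d.factorial : ℝ) * ((S.card : ℝ) * ((n + d).choose d : ℝ)) := by ring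
      _ ≤ _ := by gcongr
  · filter_upwards [eventually_ge_atTop e] with n hn
    have h : (Module.finrank K (GS K d v Finset.univ n) : ℝ) +
        Sᶜ.card * ((n - e + d).choose d : ℝ) ≤
      S.card * ((n + t + d).choose d : ℝ) + Sᶜ.card * ((n + d).choose d : ℝ) := by
        exact_mod_cast up n hn
    rw [← mul_div_assoc, ← mul_div_assoc, ← mul_div_assoc, ← add_div, ← sub_div]
    gcongr
    have h2 : (d.factorial : ℝ) * (Module.finrank K (GS K d v Finset.univ n) : ℝ) ≤
      (d.factorial : ℝ) * (S.card * ((n + t + d).choose d : ℝ) + Sᶜ.card * ((n + d).choose d : ℝ)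
        - Sᶜ.card * ((n - e + d).choose d : ℝ)) := by
      gcongr
      linarith
    linarith

end Aux

/-- Proposition 3.7 of Arveson: for a module with a proper filtration, the limit
`c = d! · lim dim M_n / n^d` exists, is a nonnegative integer, and is independent of
the choice of proper filtration. -/
theorem arveson_top_hilbert_coefficient (K : Type*) [Field K] (d : ℕ) (hd : 1 ≤ d)
    (V : Type*) [AddCommGroup V] [Module (MvPolynomial (Fin d) K) V] [Module K V]
    [IsScalarTower K (MvPolynomial (Fin d) K) V]
    (M₀ : ℕ → Submodule K V) (hM₀ : IsProperFiltration K d V M₀) :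
    ∃ c : ℕ, ∀ M : ℕ → Submodule K V, IsProperFiltration K d V M →
      Tendsto (fun n : ℕ => ((d.factorial : ℝ) * (Module.finrank K (M n) : ℝ)) / (n : ℝ) ^ d)
        atTop (nhds (c : ℝ)) := by
  classical
  obtain ⟨S, hS⟩ := exists_gen M₀ hM₀
  obtain ⟨c, hc⟩ := GS_lim (K := K) (d := d) (fun i : S => (i : V))
  refine ⟨c, fun M hM => ?_⟩
  obtain ⟨s, hs⟩ := G_le_M (fun i : S => (i : V)) Finset.univ M hM
  obtain ⟨t, ht⟩ := M_le_G (fun i : S => (i : V)) Finset.univ (by simpa using hS) M hM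
  have lt := sh_add (fun n => (d.factorial : ℝ) *
    (Module.finrank K (GS K d (fun i : S => (i : V)) Finset.univ n) : ℝ)) d c t hc
  have ls := sh_sub (fun n => (d.factorial : ℝ) *
    (Module.finrank K (GS K d (fun i : S => (i : V)) Finset.univ n) : ℝ)) d c s hc
  refine tendsto_of_tendsto_of_tendsto_of_le_of_le' ls lt ?_ ?_
  · filter_upwards [eventually_ge_atTop s] with n hn
    have := hM.2.1 n
    have h := hs (n - s)
    rw [Nat.sub_add_cancel hn] at h
    have := Submodule.finrank_mono h
    gcongr
  · refine Eventually.of_forall fun n => ?_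
    have := Submodule.finrank_mono (ht n)
    gcongr
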